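/- Let A be an order-k real tensor with dimensions (d₁,…,d_k) and let π₁, π₂ be any two partitions of [k] (not necessarily comparable). Then [dim(A)/dim_A(π₁,π₂)]^{−1/2} · ‖Unfold_{π₁}(A)‖_σ ≤ ‖Unfold_{π₂}(A)‖_σ ≤ [dim(A)/dim_A(π₂,π₁)]^{1/2} · ‖Unfold_{π₁}(A)‖_σ. -/

import Mathlib

open scoped BigOperators ENNReal

namespace TensorUnfolding

/-- The vector `l^p` norm of a finitely-indexed real vector, for `p ∈ [1, ∞]`
(for `p = ∞` it is the maximum of the absolute values of the entries). -/
noncomputable def pNorm (p : ℝ≥0∞) {ι : Type} [Fintype ι] (x : ι → ℝ) : ℝ :=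
  if p = ⊤ then ⨆ i, |x i| else (∑ i, |x i| ^ p.toReal) ^ (1 / p.toReal)

/-- `π` is a partition of `[k] = {0, …, k-1}`: a collection of disjoint nonempty
blocks whose union is all of `Fin k`. -/
def IsPartition {k : ℕ} (π : Finset (Finset (Fin k))) : Prop :=
  (∀ B ∈ π, B.Nonempty) ∧
  (∀ B ∈ π, ∀ B' ∈ π, B ≠ B' → Disjoint B B') ∧
  π.sup id = Finset.univ

/-- `π₁ ≤ π₂`: every block of `π₁` is contained in some block of `π₂`. -/
def Refines {k : ℕ} (π₁ π₂ : Finset (Finset (Fin k))) : Prop :=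
  ∀ B ∈ π₁, ∃ B' ∈ π₂, B ⊆ B'

/-- The finest partition `0_{[k]} = {{1}, …, {k}}`. -/
def botPartition (k : ℕ) : Finset (Finset (Fin k)) :=
  Finset.univ.image fun n => {n}

/-- The coarsest (one-block) partition `1_{[k]} = {[k]}`. -/
def topPartition (k : ℕ) : Finset (Finset (Fin k)) :=
  {Finset.univ}

/-- The meet `π₁ ∧ π₂`: the partition whose blocks are the nonempty
intersections `B ∩ B'` with `B ∈ π₁`, `B' ∈ π₂`. -/
def meetPartition {k : ℕ} (π₁ π₂ : Finset (Finset (Fin k))) : Finset (Finset (Fin k)) :=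
  ((π₁ ×ˢ π₂).image fun p => p.1 ∩ p.2).filter fun B => B.Nonempty

/-- The `l^p` operator norm of the unfolding of the tensor `A` induced by the
partition `π`: the supremum of `⟨A, ⊗_{B ∈ π} y_B⟩` over choices, for each block
`B ∈ π`, of a vector `y_B` indexed by `Π_{j ∈ B} Fin (d j)` with `l^p` norm 1. -/
noncomputable def unfoldNormP {k : ℕ} (p : ℝ≥0∞) (d : Fin k → ℕ)
    (A : ((n : Fin k) → Fin (d n)) → ℝ) (π : Finset (Finset (Fin k))) : ℝ :=
  sSup { r : ℝ |
    ∃ y : (B : Finset (Fin k)) → ((j : B) → Fin (d j.1)) → ℝ,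
      (∀ B ∈ π, pNorm p (y B) = 1) ∧
      r = ∑ i : (n : Fin k) → Fin (d n), A i * ∏ B ∈ π, y B fun j => i j.1 }

/-- The spectral norm of the unfolding of the tensor `A` induced by the
partition `π`: the supremum of `⟨A, ⊗_{B ∈ π} y_B⟩` over choices, for each block
`B ∈ π`, of a vector `y_B` indexed by `Π_{j ∈ B} Fin (d j)` with Euclidean norm 1. -/
noncomputable def unfoldNorm {k : ℕ} (d : Fin k → ℕ)
    (A : ((n : Fin k) → Fin (d n)) → ℝ) (π : Finset (Finset (Fin k))) : ℝ :=
  sSup { r : ℝ |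
    ∃ y : (B : Finset (Fin k)) → ((j : B) → Fin (d j.1)) → ℝ,
      (∀ B ∈ π, ∑ v, (y B v) ^ 2 = 1) ∧
      r = ∑ i : (n : Fin k) → Fin (d n), A i * ∏ B ∈ π, y B fun j => i j.1 }

/-- The `l^p` operator norm of the tensor `A`:
`‖A‖_p = sup { A(x₁, …, x_k) : ‖x_n‖_p = 1 }`. -/
noncomputable def opNormP {k : ℕ} (p : ℝ≥0∞) (d : Fin k → ℕ)
    (A : ((n : Fin k) → Fin (d n)) → ℝ) : ℝ :=
  sSup { r : ℝ | ∃ x : (n : Fin k) → Fin (d n) → ℝ,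
    (∀ n, pNorm p (x n) = 1) ∧
    r = ∑ i : (n : Fin k) → Fin (d n), A i * ∏ n, x n (i n) }

/-- The spectral norm of the tensor `A`:
`‖A‖_σ = sup { A(x₁, …, x_k) : ‖x_n‖₂ = 1 }`. -/
noncomputable def specNorm {k : ℕ} (d : Fin k → ℕ)
    (A : ((n : Fin k) → Fin (d n)) → ℝ) : ℝ :=
  sSup { r : ℝ | ∃ x : (n : Fin k) → Fin (d n) → ℝ,
    (∀ n, ∑ i, (x n i) ^ 2 = 1) ∧
    r = ∑ i : (n : Fin k) → Fin (d n), A i * ∏ n, x n (i n) }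

/-- The Frobenius norm of the tensor `A`. -/
noncomputable def frobNorm {k : ℕ} (d : Fin k → ℕ)
    (A : ((n : Fin k) → Fin (d n)) → ℝ) : ℝ :=
  Real.sqrt (∑ i : (n : Fin k) → Fin (d n), (A i) ^ 2)

/-- `D_A(B, B') = Π_{n ∈ B ∩ B'} d_n` if `B ∩ B' ≠ ∅`, and `0` otherwise. -/
def blockDim {k : ℕ} (d : Fin k → ℕ) (B B' : Finset (Fin k)) : ℕ :=
  if (B ∩ B').Nonempty then ∏ n ∈ B ∩ B', d n else 0

/-- `dim_A(π₁, π₂) = Π_{B ∈ π₁} max_{B' ∈ π₂} D_A(B, B')`. -/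
def dimRel {k : ℕ} (d : Fin k → ℕ) (π₁ π₂ : Finset (Finset (Fin k))) : ℕ :=
  ∏ B ∈ π₁, π₂.sup fun B' => blockDim d B B'

/-- `A` is `π`-orthogonal decomposable: `A = Σ_{n=1}^r λ_n a₁⁽ⁿ⁾ ⊗ ⋯ ⊗ a_k⁽ⁿ⁾`
with `λ₁ ≥ ⋯ ≥ λ_r ≥ 0` and `Π_{i ∈ B} ⟨a_i⁽ⁿ⁾, a_i⁽ᵐ⁾⟩ = δ_{nm}` for every
block `B ∈ π`. -/
def IsPiOD {k : ℕ} (d : Fin k → ℕ) (A : ((n : Fin k) → Fin (d n)) → ℝ)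
    (π : Finset (Finset (Fin k))) : Prop :=
  ∃ (r : ℕ) (lam : Fin r → ℝ) (a : Fin r → (n : Fin k) → Fin (d n) → ℝ),
    Antitone lam ∧ (∀ n, 0 ≤ lam n) ∧
    (∀ i, A i = ∑ n, lam n * ∏ m, a n m (i m)) ∧
    (∀ B ∈ π, ∀ n m : Fin r,
      (∏ j ∈ B, ∑ t, a n j t * a m j t) = if n = m then 1 else 0)

end TensorUnfolding

namespace TensorUnfolding

section

variable {k : ℕ} {d : Fin k → ℕ} {π π₁ π₂ : Finset (Finset (Fin k))}

lemma IsPartition.exists_mem (h : IsPartition π) (n : Fin k) : ∃ B ∈ π, n ∈ B := by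
  have hn : n ∈ π.sup id := by rw [h.2.2]; exact Finset.mem_univ n
  simpa [Finset.mem_sup] using hn

lemma IsPartition.eq_of_mem (h : IsPartition π) {B B' : Finset (Fin k)} (hB : B ∈ π)
    (hB' : B' ∈ π) {n : Fin k} (hn : n ∈ B) (hn' : n ∈ B') : B = B' := by
  by_contra hne
  exact Finset.disjoint_left.1 (h.2.1 B hB B' hB' hne) hn hn'

/-- Restricting a multi-index to the blocks of a partition is a bijection. -/
lemma IsPartition.restrict_bijective (h : IsPartition π) (d : Fin k → ℕ) :
    Function.Bijective fun (i : (n : Fin k) → Fin (d n)) (B : π) (j : B.1) => i j.1 := by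
  constructor
  · intro i i' hii
    funext n
    obtain ⟨B, hB, hn⟩ := h.exists_mem n
    exact congrFun (congrFun hii ⟨B, hB⟩) ⟨n, hn⟩
  · intro g
    choose b hb hnb using h.exists_mem
    refine ⟨fun n => g ⟨b n, hb n⟩ ⟨n, hnb n⟩, ?_⟩
    funext ⟨B, hB⟩ ⟨n, hn⟩
    obtain rfl := h.eq_of_mem hB (hb n) hn (hnb n)
    rfl

lemma IsPartition.sum_prod_eq_prod_sum (h : IsPartition π)
    (g : (B : Finset (Fin k)) → ((j : B) → Fin (d j.1)) → ℝ) :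
    ∑ i : (n : Fin k) → Fin (d n), ∏ B ∈ π, g B (fun j => i j.1) =
      ∏ B ∈ π, ∑ v, g B v := by
  rw [← Finset.prod_coe_sort π, Fintype.prod_sum]
  refine Fintype.sum_bijective _ (h.restrict_bijective d) _ _ fun i => ?_
  exact (Finset.prod_coe_sort π fun B => g B fun j => i j.1).symm

lemma bddAbove_unfold (d : Fin k → ℕ) (A : ((n : Fin k) → Fin (d n)) → ℝ)
    (π : Finset (Finset (Fin k))) :
    BddAbove { r : ℝ |
      ∃ y : (B : Finset (Fin k)) → ((j : B) → Fin (d j.1)) → ℝ,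
        (∀ B ∈ π, ∑ v, (y B v) ^ 2 = 1) ∧
        r = ∑ i : (n : Fin k) → Fin (d n), A i * ∏ B ∈ π, y B fun j => i j.1 } := by
  refine ⟨∑ i, |A i|, ?_⟩
  rintro _ ⟨y, hy, rfl⟩
  refine Finset.sum_le_sum fun i _ => (le_abs_self _).trans ?_
  rw [abs_mul, Finset.abs_prod]
  refine mul_le_of_le_one_right (abs_nonneg _)
    (Finset.prod_le_one (fun _ _ => abs_nonneg _) fun B hB => ?_)
  rw [← sq_le_one_iff_abs_le_one, ← hy B hB]
  exact Finset.single_le_sum (f := fun v => y B v ^ 2) (fun _ _ => sq_nonneg _)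
    (Finset.mem_univ _)

lemma exists_unit_family (hd : ∀ n, 1 ≤ d n) :
    ∃ y : (B : Finset (Fin k)) → ((j : B) → Fin (d j.1)) → ℝ,
      ∀ B, ∑ v, (y B v) ^ 2 = 1 := by
  refine ⟨fun B v => if v = fun j => ⟨0, hd j.1⟩ then 1 else 0, fun B => ?_⟩
  simp

lemma unfoldNorm_nonneg (hd : ∀ n, 1 ≤ d n) (A : ((n : Fin k) → Fin (d n)) → ℝ)
    (hπ : π.Nonempty) : 0 ≤ unfoldNorm d A π := by
  obtain ⟨y, hy⟩ := exists_unit_family hd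
  obtain ⟨C, hC⟩ := hπ
  have h1 := le_csSup (bddAbove_unfold d A π) ⟨y, fun B _ => hy B, rfl⟩
  have h2 := le_csSup (bddAbove_unfold d A π)
    ⟨Function.update y C (-y C), fun B _ => by
      by_cases h : B = C
      · subst h; simpa using hy B
      · simpa [h] using hy B, rfl⟩
  have h3 : ∀ i : (n : Fin k) → Fin (d n),
      A i * ∏ B ∈ π, Function.update y C (-y C) B (fun j => i j.1) =
        -(A i * ∏ B ∈ π, y B fun j => i j.1) := by
    intro i
    rw [← Finset.mul_prod_erase _ _ hC, ← Finset.mul_prod_erase π _ hC,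
      Finset.prod_congr rfl fun B hB => by
        rw [Function.update_of_ne (Finset.ne_of_mem_erase hB)]]
    simp
  simp only [h3, Finset.sum_neg_distrib] at h2
  unfold unfoldNorm
  linarith

/-- Homogeneous form of the bound defining the spectral norm. -/
lemma sum_mul_prod_le (h : IsPartition π) (A : ((n : Fin k) → Fin (d n)) → ℝ)
    (z : (B : Finset (Fin k)) → ((j : B) → Fin (d j.1)) → ℝ) :
    ∑ i, A i * ∏ B ∈ π, z B (fun j => i j.1) ≤
      unfoldNorm d A π * √(∑ i : (n : Fin k) → Fin (d n),
        (∏ B ∈ π, z B (fun j => i j.1)) ^ 2) := by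
  have hnorm : ∑ i : (n : Fin k) → Fin (d n), (∏ B ∈ π, z B (fun j => i j.1)) ^ 2 =
      ∏ B ∈ π, ∑ v, z B v ^ 2 := by
    simp only [← Finset.prod_pow]
    exact h.sum_prod_eq_prod_sum fun B v => z B v ^ 2
  by_cases h0 : ∏ B ∈ π, ∑ v, z B v ^ 2 = 0
  · have hz : ∀ i : (n : Fin k) → Fin (d n), ∏ B ∈ π, z B (fun j => i j.1) = 0 := by
      intro i
      rw [← hnorm, Finset.sum_eq_zero_iff_of_nonneg fun _ _ => sq_nonneg _] at h0
      simpa using h0 i (Finset.mem_univ i)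
    simp [hz]
  · have hpos : ∀ B ∈ π, 0 < ∑ v, z B v ^ 2 := fun B hB =>
      (Finset.sum_nonneg fun _ _ => sq_nonneg _).lt_of_ne'
        (Finset.prod_ne_zero_iff.1 h0 B hB)
    have hs : 0 < ∏ B ∈ π, √(∑ v, z B v ^ 2) :=
      Finset.prod_pos fun B hB => Real.sqrt_pos.2 (hpos B hB)
    have hle := le_csSup (bddAbove_unfold d A π)
      ⟨fun B v => z B v / √(∑ v, z B v ^ 2), fun B hB => by
        simp only [div_pow, Real.sq_sqrt (hpos B hB).le, ← Finset.sum_div]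
        exact div_self (hpos B hB).ne', rfl⟩
    simp only [Finset.prod_div_distrib, ← mul_div_assoc, ← Finset.sum_div] at hle
    rw [div_le_iff₀ hs] at hle
    rwa [hnorm, Real.sqrt_prod _ fun B hB => (hpos B hB).le]

/-- After fixing the indices outside `⋃ B ∩ f B`, a product over the blocks of `π₁` becomes
a product over the blocks of `π₂`. -/
lemma exists_slice_factorization (h₂ : IsPartition π₂)
    (f : Finset (Fin k) → Finset (Fin k)) (hf : ∀ B ∈ π₁, f B ∈ π₂)
    (y : (B : Finset (Fin k)) → ((j : B) → Fin (d j.1)) → ℝ)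
    (w : (n : Fin k) → Fin (d n)) :
    ∃ z : (B : Finset (Fin k)) → ((j : B) → Fin (d j.1)) → ℝ,
      ∀ i : (n : Fin k) → Fin (d n),
        ∏ B ∈ π₂, z B (fun j => i j.1) =
          if ∀ n ∈ π₁.biUnion (fun B => B \ f B), i n = w n
          then ∏ B ∈ π₁, y B (fun j => i j.1) else 0 := by
  classical
  refine ⟨fun B' v => if ∀ j : B', j.1 ∈ π₁.biUnion (fun B => B \ f B) → v j = w j.1
    then ∏ B ∈ π₁ with f B = B', y B (fun j => if h : j.1 ∈ B' then v ⟨j.1, h⟩ else w j.1)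
    else 0, fun i => ?_⟩
  split_ifs with hi
  · rw [← Finset.prod_fiberwise_of_maps_to hf]
    refine Finset.prod_congr rfl fun B' _ => ?_
    refine (if_pos fun (j : B') hj => hi j.1 hj).trans ?_
    refine Finset.prod_congr rfl fun B hB => ?_
    rw [Finset.mem_filter] at hB
    congr 1
    funext j
    split_ifs with hj
    · rfl
    · refine (hi j.1 (Finset.mem_biUnion.2 ⟨B, hB.1, Finset.mem_sdiff.2 ⟨j.2, ?_⟩⟩)).symm
      rwa [hB.2]
  · push Not at hi
    obtain ⟨n, hn, hne⟩ := hi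
    obtain ⟨B', hB', hnB'⟩ := h₂.exists_mem n
    exact Finset.prod_eq_zero hB' (if_neg fun hall => hne (hall ⟨n, hnB'⟩ hn))

lemma unfoldNorm_le_sqrt_prod_mul (hd : ∀ n, 1 ≤ d n)
    (A : ((n : Fin k) → Fin (d n)) → ℝ) (h₁ : IsPartition π₁) (h₂ : IsPartition π₂)
    (hne : π₂.Nonempty) (f : Finset (Fin k) → Finset (Fin k)) (hf : ∀ B ∈ π₁, f B ∈ π₂) :
    unfoldNorm d A π₁ ≤
      √(∏ n ∈ π₁.biUnion (fun B => B \ f B), (d n : ℝ)) * unfoldNorm d A π₂ := by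
  classical
  obtain ⟨y₀, hy₀⟩ := exists_unit_family hd
  refine csSup_le ⟨_, y₀, fun B _ => hy₀ B, rfl⟩ ?_
  rintro _ ⟨y, hy, rfl⟩
  set R := π₁.biUnion (fun B => B \ f B) with hR
  set T : ((n : Fin k) → Fin (d n)) → ℝ := fun i => ∏ B ∈ π₁, y B (fun j => i j.1) with hT
  let res : ((n : Fin k) → Fin (d n)) → ((n : R) → Fin (d n.1)) := fun i n => i n.1
  have hTnorm : ∑ i, T i ^ 2 = 1 := by
    simp only [hT, ← Finset.prod_pow]
    rw [h₁.sum_prod_eq_prod_sum fun B v => y B v ^ 2]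
    exact Finset.prod_eq_one hy
  have hslice : ∀ w : (n : R) → Fin (d n.1),
      ∑ i with res i = w, A i * T i ≤
        unfoldNorm d A π₂ * √(∑ i with res i = w, T i ^ 2) := by
    intro w
    obtain ⟨z, hz⟩ := exists_slice_factorization h₂ f hf y
      (fun n => if h : n ∈ R then w ⟨n, h⟩ else ⟨0, hd n⟩)
    have hz' : ∀ i : (n : Fin k) → Fin (d n),
        ∏ B ∈ π₂, z B (fun j => i j.1) = if res i = w then T i else 0 := by
      intro i
      rw [hz i]
      refine if_congr ⟨fun h => ?_, fun h n hn => ?_⟩ rfl rfl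
      · funext n
        simpa [res, n.2] using h n.1 n.2
      · rw [dif_pos hn, ← h]
    have := sum_mul_prod_le h₂ A z
    simpa [hz', Finset.sum_filter] using this
  have hcard : (Fintype.card ((n : R) → Fin (d n.1)) : ℝ) = ∏ n ∈ R, (d n : ℝ) := by
    rw [Fintype.card_pi]
    simp only [Fintype.card_fin, Nat.cast_prod]
    exact Finset.prod_coe_sort R fun n => (d n : ℝ)
  have hCS : ∑ w : (n : R) → Fin (d n.1), √(∑ i with res i = w, T i ^ 2) ≤
      √(∏ n ∈ R, (d n : ℝ)) := by
    refine Real.le_sqrt_of_sq_le ?_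
    refine sq_sum_le_card_mul_sum_sq.trans_eq ?_
    rw [Finset.card_univ, hcard]
    simp only [Real.sq_sqrt (Finset.sum_nonneg fun _ _ => sq_nonneg _)]
    rw [Finset.sum_fiberwise, hTnorm, mul_one]
  calc ∑ i, A i * T i = ∑ w, ∑ i with res i = w, A i * T i :=
        (Finset.sum_fiberwise _ _ _).symm
    _ ≤ ∑ w, unfoldNorm d A π₂ * √(∑ i with res i = w, T i ^ 2) :=
        Finset.sum_le_sum fun w _ => hslice w
    _ = (∑ w, √(∑ i with res i = w, T i ^ 2)) * unfoldNorm d A π₂ := by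
        rw [← Finset.mul_sum, mul_comm]
    _ ≤ _ := mul_le_mul_of_nonneg_right hCS (unfoldNorm_nonneg hd A hne)

/-- For each block of `π₁` choose a block of `π₂` realising the maximum in `dimRel`. -/
lemma exists_dimRel_eq_prod (hd : ∀ n, 1 ≤ d n) (h₁ : IsPartition π₁)
    (h₂ : IsPartition π₂) (hne : π₂.Nonempty) :
    ∃ f : Finset (Fin k) → Finset (Fin k), (∀ B ∈ π₁, f B ∈ π₂) ∧
      dimRel d π₁ π₂ = ∏ B ∈ π₁, ∏ n ∈ B ∩ f B, d n := by
  choose f hf hsup using fun B => Finset.exists_mem_eq_sup π₂ hne fun B' => blockDim d B B'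
  refine ⟨f, fun B _ => hf B, Finset.prod_congr rfl fun B hB => ?_⟩
  rw [hsup B, blockDim, if_pos]
  by_contra hemp
  obtain ⟨n, hn⟩ := h₁.1 B hB
  obtain ⟨B', hB', hn'⟩ := h₂.exists_mem n
  have hle := Finset.le_sup (f := fun B' => blockDim d B B') hB'
  have hmem : (B ∩ B').Nonempty := ⟨n, Finset.mem_inter.2 ⟨hn, hn'⟩⟩
  rw [hsup B] at hle
  simp only [blockDim, if_neg hemp, if_pos hmem] at hle
  have hpos : 0 < ∏ n ∈ B ∩ B', d n := Finset.prod_pos fun n _ => hd n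
  omega

lemma IsPartition.prod_eq_mul (h : IsPartition π) (f : Finset (Fin k) → Finset (Fin k)) :
    ∏ n, d n = (∏ n ∈ π.biUnion (fun B => B \ f B), d n) * ∏ B ∈ π, ∏ n ∈ B ∩ f B, d n := by
  have hdisj : Set.PairwiseDisjoint (π : Set (Finset (Fin k))) id :=
    fun B hB B' hB' hne => h.2.1 B hB B' hB' hne
  have huniv : (Finset.univ : Finset (Fin k)) = π.biUnion id := by
    rw [← h.2.2, Finset.sup_eq_biUnion]
  have hdiff : Set.PairwiseDisjoint (π : Set (Finset (Fin k))) fun B => B \ f B :=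
    fun B hB B' hB' hne =>
      (h.2.1 B hB B' hB' hne).mono Finset.sdiff_subset Finset.sdiff_subset
  rw [huniv, Finset.prod_biUnion hdisj, Finset.prod_biUnion hdiff,
    ← Finset.prod_mul_distrib]
  refine Finset.prod_congr rfl fun B _ => ?_
  rw [mul_comm, id, Finset.prod_inter_mul_prod_sdiff]

lemma div_dimRel_pos (hd : ∀ n, 1 ≤ d n) (h₁ : IsPartition π₁) (h₂ : IsPartition π₂)
    (hne : π₂.Nonempty) : 0 < (∏ n : Fin k, (d n : ℝ)) / (dimRel d π₁ π₂ : ℝ) := by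
  obtain ⟨f, -, hdim⟩ := exists_dimRel_eq_prod hd h₁ h₂ hne
  have hd' : ∀ n, 0 < d n := hd
  refine div_pos (Finset.prod_pos fun n _ => Nat.cast_pos.2 (hd' n)) (Nat.cast_pos.2 ?_)
  rw [hdim]
  exact Finset.prod_pos fun B _ => Finset.prod_pos fun n _ => hd' n

lemma unfoldNorm_le_rpow_mul (hd : ∀ n, 1 ≤ d n) (A : ((n : Fin k) → Fin (d n)) → ℝ)
    (h₁ : IsPartition π₁) (h₂ : IsPartition π₂) (hne : π₂.Nonempty) :
    unfoldNorm d A π₁ ≤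
      ((∏ n : Fin k, (d n : ℝ)) / (dimRel d π₁ π₂ : ℝ)) ^ ((1 : ℝ) / 2) *
        unfoldNorm d A π₂ := by
  obtain ⟨f, hf, hdim⟩ := exists_dimRel_eq_prod hd h₁ h₂ hne
  have hpos : (0 : ℝ) < dimRel d π₁ π₂ := by
    rw [hdim]
    exact Nat.cast_pos.2 (Finset.prod_pos fun B _ => Finset.prod_pos fun n _ => hd n)
  have hquot : (∏ n : Fin k, (d n : ℝ)) / (dimRel d π₁ π₂ : ℝ) =
      ∏ n ∈ π₁.biUnion (fun B => B \ f B), (d n : ℝ) := by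
    rw [div_eq_iff hpos.ne', hdim]
    exact_mod_cast h₁.prod_eq_mul f
  rw [hquot, ← Real.sqrt_eq_rpow]
  exact unfoldNorm_le_sqrt_prod_mul hd A h₁ h₂ hne f hf

lemma IsPartition.nonempty_iff (h₁ : IsPartition π₁) : π₁.Nonempty ↔ Nonempty (Fin k) := by
  constructor
  · rintro ⟨B, hB⟩
    obtain ⟨n, -⟩ := h₁.1 B hB
    exact ⟨n⟩
  · rintro ⟨n⟩
    obtain ⟨B, hB, -⟩ := h₁.exists_mem n
    exact ⟨B, hB⟩

end

end TensorUnfolding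

open TensorUnfolding in
/-- **Spectral norm inequalities.** For any two partitions
`π₁, π₂` of `[k]` (not necessarily comparable),
`[dim(A)/dim_A(π₁,π₂)]^{-1/2} ‖Unfold_{π₁}(A)‖_σ ≤ ‖Unfold_{π₂}(A)‖_σ ≤
 [dim(A)/dim_A(π₂,π₁)]^{1/2} ‖Unfold_{π₁}(A)‖_σ`. -/
theorem spectral_norm_inequalities {k : ℕ} (d : Fin k → ℕ) (hd : ∀ n, 1 ≤ d n)
    (A : ((n : Fin k) → Fin (d n)) → ℝ)
    (π₁ π₂ : Finset (Finset (Fin k)))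
    (h₁ : IsPartition π₁) (h₂ : IsPartition π₂) :
    ((∏ n : Fin k, (d n : ℝ)) / (dimRel d π₁ π₂ : ℝ)) ^ (-(1 / 2) : ℝ) *
        unfoldNorm d A π₁ ≤ unfoldNorm d A π₂ ∧
    unfoldNorm d A π₂ ≤
      ((∏ n : Fin k, (d n : ℝ)) / (dimRel d π₂ π₁ : ℝ)) ^ ((1 : ℝ) / 2) *
        unfoldNorm d A π₁ := by
  rcases isEmpty_or_nonempty (Fin k) with hk | hk
  · have hempty : ∀ π : Finset (Finset (Fin k)), IsPartition π → π = ∅ := fun π h =>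
      Finset.not_nonempty_iff_eq_empty.1 fun hne => hk.false (h.nonempty_iff.1 hne).some
    rw [hempty π₁ h₁, hempty π₂ h₂]
    simp [dimRel]
  · have hne₁ := h₁.nonempty_iff.2 hk
    have hne₂ := h₂.nonempty_iff.2 hk
    refine ⟨?_, unfoldNorm_le_rpow_mul hd A h₂ h₁ hne₁⟩
    have hpos := div_dimRel_pos hd h₁ h₂ hne₂
    rw [Real.rpow_neg hpos.le, inv_mul_le_iff₀ (Real.rpow_pos_of_pos hpos _)]
    exact unfoldNorm_le_rpow_mul hd A h₁ h₂ hne₂
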